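/- There exists an integer c > β such that 𝔪^{c(n_0+|𝐧|)} ∩ 𝐉_𝐧 = 𝔪^{c(n_0+|𝐧|)} ∩ I_{n_0}𝐉_𝐧 for all n_0 ∈ ℕ and 𝐧 = (n_1,…,n_r) ∈ ℕ^r. -/

import Mathlib

open Filter MvPolynomial Pointwise MeasureTheory

noncomputable section

/-- The graded irrelevant (maximal graded) ideal `𝔪 = (x_1, …, x_d)` of `𝕜[x_1, …, x_d]`. -/
def mId (𝕜 : Type*) [Field 𝕜] (d : ℕ) : Ideal (MvPolynomial (Fin d) 𝕜) :=
  Ideal.span (Set.range MvPolynomial.X)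

/-- A graded family of ideals: `I 0 = R` and `I i * I j ⊆ I (i + j)`. -/
def IsGradedFamily {R : Type*} [CommSemiring R] (I : ℕ → Ideal R) : Prop :=
  I 0 = ⊤ ∧ ∀ i j : ℕ, I i * I j ≤ I (i + j)

/-- An `𝔪`-primary ideal of the polynomial ring: a proper ideal containing a power of `𝔪`. -/
def IsMPrimary {𝕜 : Type*} [Field 𝕜] {d : ℕ} (I : Ideal (MvPolynomial (Fin d) 𝕜)) : Prop :=
  I ≠ ⊤ ∧ ∃ k : ℕ, mId 𝕜 d ^ k ≤ I

/-- A monomial ideal: an ideal generated by monomials. -/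
def IsMonomialIdeal {𝕜 : Type*} [Field 𝕜] {d : ℕ} (I : Ideal (MvPolynomial (Fin d) 𝕜)) : Prop :=
  ∃ S : Set (Fin d →₀ ℕ), I = Ideal.span ((fun m => MvPolynomial.monomial m (1 : 𝕜)) '' S)

/-- A nonzero monomial ideal generated by monomials of degree at most `b`;
for nonzero monomial ideals this is exactly the condition `β(I) ≤ b`. -/
def IsMonomialBounded {𝕜 : Type*} [Field 𝕜] {d : ℕ} (I : Ideal (MvPolynomial (Fin d) 𝕜))
    (b : ℕ) : Prop :=
  I ≠ ⊥ ∧ ∃ S : Set (Fin d →₀ ℕ), (∀ m ∈ S, (∑ j, m j) ≤ b) ∧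
    I = Ideal.span ((fun m => MvPolynomial.monomial m (1 : 𝕜)) '' S)

/-- The `𝕜`-vector space dimension of the quotient `A / (A ⊓ B)`; for `B ⊆ A`
this is `dim_𝕜 (A / B)`. -/
def quotDim (𝕜 : Type*) [Field 𝕜] {R : Type*} [CommRing R] [Algebra 𝕜 R]
    (A B : Ideal R) : ℕ :=
  Module.finrank 𝕜
    (↥(Submodule.restrictScalars 𝕜 A) ⧸
      Submodule.comap (Submodule.restrictScalars 𝕜 A).subtype (Submodule.restrictScalars 𝕜 B))

section Auxiliary

variable {𝕜 : Type*} [Field 𝕜] {d : ℕ}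

/-- A monomial lies in `𝔪 ^ k` as soon as its degree is at least `k`. -/
lemma monomial_mem_mId_pow {k : ℕ} {m : Fin d →₀ ℕ} (hm : k ≤ ∑ j, m j) (a : 𝕜) :
    monomial m a ∈ mId 𝕜 d ^ k := by
  change monomial m a ∈ idealOfVars (Fin d) 𝕜 ^ k
  rw [mem_pow_idealOfVars_iff]
  intro x hx
  rw [Finset.mem_singleton.mp (support_monomial_subset hx), Finsupp.degree_eq_sum]
  exact hm

/-- Every monomial in the support of an element of `𝔪 ^ k` has degree at least `k`. -/
lemma le_degree_of_mem_mId_pow {k : ℕ} {f : MvPolynomial (Fin d) 𝕜} (hf : f ∈ mId 𝕜 d ^ k)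
    {m : Fin d →₀ ℕ} (hm : m ∈ f.support) : k ≤ ∑ j, m j := by
  change f ∈ idealOfVars (Fin d) 𝕜 ^ k at hf
  rw [mem_pow_idealOfVars_iff] at hf
  rw [← Finsupp.degree_eq_sum]
  exact hf m hm

/-- In a graded family, `(I a) ^ n ⊆ I (a * n)`. -/
lemma IsGradedFamily.pow_le {R : Type*} [CommSemiring R] {I : ℕ → Ideal R}
    (hI : IsGradedFamily I) (a n : ℕ) : I a ^ n ≤ I (a * n) := by
  induction n with
  | zero => simp [hI.1]
  | succ n ih =>
    rw [pow_succ, mul_add_one]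
    exact (Ideal.mul_mono_left ih).trans (hI.2 _ _)

/-- A product of ideals generated by monomials of degrees at most `b i` is generated by monomials
of degree at most `∑ i, b i`. -/
lemma exists_prod_eq_span_monomial {ι : Type*} (s : Finset ι)
    (J : ι → Ideal (MvPolynomial (Fin d) 𝕜)) (b : ι → ℕ)
    (hJ : ∀ i ∈ s, IsMonomialBounded (J i) (b i)) :
    ∃ S : Set (Fin d →₀ ℕ), (∀ m ∈ S, (∑ j, m j) ≤ ∑ i ∈ s, b i) ∧
      ∏ i ∈ s, J i = Ideal.span ((fun m => monomial m (1 : 𝕜)) '' S) := by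
  classical
  induction s using Finset.induction_on with
  | empty =>
    refine ⟨{0}, by simp, ?_⟩
    rw [Finset.prod_empty, Set.image_singleton, monomial_zero', C_1, Ideal.span_singleton_one,
      Ideal.one_eq_top]
  | insert a s ha ih =>
    obtain ⟨S, hS, hprod⟩ := ih fun i hi => hJ i (Finset.mem_insert_of_mem hi)
    obtain ⟨-, T, hT, hJa⟩ := hJ a (Finset.mem_insert_self a s)
    refine ⟨T + S, ?_, ?_⟩
    · rintro _ ⟨t, ht, u, hu, rfl⟩
      rw [Finset.sum_insert ha]
      simpa [Finset.sum_add_distrib] using add_le_add (hT t ht) (hS u hu)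
    · rw [Finset.prod_insert ha, hJa, hprod, Ideal.span_mul_span]
      congr 1
      refine (Set.image_image2_distrib fun t u => ?_).symm
      simp [monomial_mul]

/-- If `K` is generated by monomials of degree at most `b`, then
`𝔪 ^ (a + b) ∩ K ⊆ 𝔪 ^ a * K`. -/
lemma mId_pow_inf_span_monomial_le (a b : ℕ) {S : Set (Fin d →₀ ℕ)}
    (hS : ∀ m ∈ S, (∑ j, m j) ≤ b) :
    mId 𝕜 d ^ (a + b) ⊓ Ideal.span ((fun m => monomial m (1 : 𝕜)) '' S) ≤
      mId 𝕜 d ^ a * Ideal.span ((fun m => monomial m (1 : 𝕜)) '' S) := by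
  rintro f ⟨hfm, hfS⟩
  rw [f.as_sum]
  refine Ideal.sum_mem _ fun m hm => ?_
  obtain ⟨u, hu, hum⟩ := mem_ideal_span_monomial_image.mp hfS m hm
  obtain ⟨v, rfl⟩ := le_iff_exists_add'.mp hum
  have hdeg := le_degree_of_mem_mId_pow hfm hm
  simp only [Finsupp.add_apply, Finset.sum_add_distrib] at hdeg
  have hmul : monomial (v + u) (coeff (v + u) f) =
      monomial v (coeff (v + u) f) * monomial u (1 : 𝕜) := by simp [monomial_mul]
  rw [hmul]
  exact Ideal.mul_mem_mul (monomial_mem_mId_pow (by have := hS u hu; omega) _)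
    (Ideal.subset_span ⟨u, hu, rfl⟩)

end Auxiliary

/-- **Lemma: a uniform intersection constant.**
There exists an integer `c > β` such that
`𝔪^{c(n₀+|𝐧|)} ∩ 𝐉_𝐧 = 𝔪^{c(n₀+|𝐧|)} ∩ I_{n₀}𝐉_𝐧` for all `n₀ ∈ ℕ` and `𝐧 ∈ ℕ^r`. -/
theorem statement4 {𝕜 : Type*} [Field 𝕜] (d r : ℕ) (hd : 0 < d)
    (I : ℕ → Ideal (MvPolynomial (Fin d) 𝕜))
    (J : Fin r → ℕ → Ideal (MvPolynomial (Fin d) 𝕜)) (β : ℕ)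
    (hI : IsGradedFamily I)
    (hImon : ∀ n, IsMonomialIdeal (I n))
    (hIprim : ∀ n, 0 < n → IsMPrimary (I n))
    (hJ : ∀ i, IsGradedFamily (J i))
    (hJb : ∀ i n, IsMonomialBounded (J i n) (β * n)) :
    ∃ c : ℕ, β < c ∧
      ∀ (n0 : ℕ) (n : Fin r → ℕ),
        mId 𝕜 d ^ (c * (n0 + ∑ i, n i)) ⊓ (∏ i, J i (n i)) =
          mId 𝕜 d ^ (c * (n0 + ∑ i, n i)) ⊓ (I n0 * ∏ i, J i (n i)) := by
  obtain ⟨k, hk⟩ := (hIprim 1 one_pos).2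
  refine ⟨β + k + 1, by omega, fun n0 n => le_antisymm (le_inf inf_le_left ?_)
    (inf_le_inf_left _ Ideal.mul_le_right)⟩
  obtain ⟨S, hS, hprod⟩ := exists_prod_eq_span_monomial Finset.univ (fun i => J i (n i))
    (fun i => β * n i) fun i _ => hJb i (n i)
  rw [← Finset.mul_sum] at hS
  have hpow : mId 𝕜 d ^ (k * n0) ≤ I n0 := by
    rw [pow_mul]
    simpa using (Ideal.pow_right_mono hk n0).trans (hI.pow_le 1 n0)
  have hle : k * n0 + β * ∑ i, n i ≤ (β + k + 1) * (n0 + ∑ i, n i) := by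
    rw [mul_add]
    gcongr <;> omega
  rw [hprod]
  calc _ ≤ mId 𝕜 d ^ (k * n0 + β * ∑ i, n i) ⊓
          Ideal.span ((fun m => monomial m (1 : 𝕜)) '' S) :=
        inf_le_inf_right _ (Ideal.pow_le_pow_right hle)
    _ ≤ mId 𝕜 d ^ (k * n0) * Ideal.span ((fun m => monomial m (1 : 𝕜)) '' S) :=
        mId_pow_inf_span_monomial_le _ _ hS
    _ ≤ _ := Ideal.mul_mono_left hpow
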